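/- Let S and T be two finite trees, each on at least 3 vertices. If the degree profiles of S and T differ, i.e., \vec{d}(S) ≠ \vec{d}(T), then δ(S,T) > 0, where δ(S,T) = lim_{n→∞} TV(PA(n,S), PA(n,T)). -/

import Mathlib

open MeasureTheory Filter Real
open scoped ENNReal

noncomputable section

/-- The degree of vertex `v` in a graph on `ℕ`. -/
def degN (G : SimpleGraph ℕ) (v : ℕ) : ℕ := (G.neighborSet v).ncard

/-- `G` is a tree on the vertex set `{0, …, k-1}` (all other vertices isolated). -/
def IsTreeOn (k : ℕ) (G : SimpleGraph ℕ) : Prop :=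
  (∀ v w : ℕ, G.Adj v w → v < k ∧ w < k) ∧ (G.induce {v : ℕ | v < k}).IsTree

instance : MeasurableSpace (SimpleGraph ℕ) := ⊤

/-- Add the edge `uv` to `G`. -/
def addEdge (G : SimpleGraph ℕ) (u v : ℕ) : SimpleGraph ℕ :=
  G ⊔ SimpleGraph.fromEdgeSet {s(u, v)}

/-- One step of preferential attachment: the current graph has `n` vertices `0, …, n-1`;
the new vertex `n` attaches to an existing vertex `v` with probability `deg v / (2(n-1))`. -/
def paStep (n : ℕ) (G : SimpleGraph ℕ) : Measure (SimpleGraph ℕ) :=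
  Measure.sum fun v : ℕ =>
    ((degN G v : ℝ≥0∞) / ((2 * (n - 1) : ℕ) : ℝ≥0∞)) • Measure.dirac (addEdge G n v)

def PAlawAux (k : ℕ) (T : SimpleGraph ℕ) : ℕ → Measure (SimpleGraph ℕ)
  | 0 => Measure.dirac T
  | m + 1 => (PAlawAux k T m).bind (paStep (k + m))

/-- The law of `PA(n, T)` for a seed tree `T` on `k` vertices, as a measure on labelled
graphs on `ℕ` (vertices are labelled `0, 1, 2, …` in order of arrival). -/
def PAlaw (k : ℕ) (T : SimpleGraph ℕ) (n : ℕ) : Measure (SimpleGraph ℕ) :=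
  PAlawAux k T (n - k)

/-- Graphs on `ℕ` up to isomorphism. -/
def graphSetoid : Setoid (SimpleGraph ℕ) where
  r G H := Nonempty (G ≃g H)
  iseqv := ⟨fun G => ⟨RelIso.refl G.Adj⟩, fun ⟨e⟩ => ⟨e.symm⟩, fun ⟨e⟩ ⟨f⟩ => ⟨e.trans f⟩⟩

/-- Isomorphism types of graphs on `ℕ`. -/
def GraphType : Type := Quotient graphSetoid

instance : MeasurableSpace GraphType := ⊤

/-- The law of the isomorphism type of `PA(n, T)`. -/
def PAtype (k : ℕ) (T : SimpleGraph ℕ) (n : ℕ) : Measure GraphType :=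
  (PAlaw k T n).map (Quotient.mk graphSetoid)

/-- Total variation distance between two measures. -/
def tvDist {α : Type*} [MeasurableSpace α] (μ ν : Measure α) : ℝ :=
  ⨆ A : Set α, |(μ A).toReal - (ν A).toReal|

/-- `δ(S, T) = lim_n TV(PA(n,S), PA(n,T))`, the total variation distance being taken
between the laws of the isomorphism types.  The limit exists since the sequence is
non-increasing; we express it as a `limsup`, which agrees with the limit. -/
def deltaPA (kS : ℕ) (S : SimpleGraph ℕ) (kT : ℕ) (T : SimpleGraph ℕ) : ℝ :=
  Filter.limsup (fun n : ℕ => tvDist (PAtype kS S n) (PAtype kT T n)) Filter.atTop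


/-- The degree profile of a graph on `{0, …, k-1}`: the vector of degrees arranged in
decreasing order, continued with zeros after the `k`-th coordinate. -/
def vecd (k : ℕ) (G : SimpleGraph ℕ) : ℕ → ℕ :=
  fun i => ((((Multiset.range k).map (degN G)).sort (· ≤ ·)).reverse).getD i 0


/-- The part of being a tree on `{0, …, n-1}` that preferential attachment needs: edges stay below
`n`, there are no isolated vertices, and the degrees sum to `2(n-1)`. -/
structure TreeLike (n : ℕ) (G : SimpleGraph ℕ) : Prop where
  adj_lt : ∀ v w : ℕ, G.Adj v w → v < n ∧ w < n
  one_le_degN : ∀ v < n, 1 ≤ degN G v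
  sum_degN : ∑ v ∈ Finset.range n, degN G v = 2 * (n - 1)

lemma TreeLike.finite_neighborSet {n : ℕ} {G : SimpleGraph ℕ} (h : TreeLike n G) (v : ℕ) :
    (G.neighborSet v).Finite :=
  (Set.finite_lt_nat n).subset fun w hw => (h.adj_lt v w hw).2

lemma TreeLike.degN_eq_zero {n : ℕ} {G : SimpleGraph ℕ} (h : TreeLike n G) {v : ℕ} (hv : n ≤ v) :
    degN G v = 0 := by
  have : G.neighborSet v = ∅ := by
    ext w
    simp only [SimpleGraph.mem_neighborSet, Set.mem_empty_iff_false, iff_false]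
    intro hw
    have := (h.adj_lt v w hw).1
    omega
  simp [degN, this]

lemma TreeLike.degN_le {n : ℕ} {G : SimpleGraph ℕ} (h : TreeLike n G) (v : ℕ) :
    degN G v ≤ 2 * (n - 1) := by
  by_cases hv : v < n
  · rw [← h.sum_degN]
    exact Finset.single_le_sum (f := degN G) (fun _ _ => Nat.zero_le _) (Finset.mem_range.2 hv)
  · rw [h.degN_eq_zero (not_lt.1 hv)]
    exact Nat.zero_le _

lemma TreeLike.degN_addEdge {n : ℕ} {G : SimpleGraph ℕ} (h : TreeLike n G) {v : ℕ} (hv : v < n)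
    (w : ℕ) :
    degN (addEdge G n v) w =
      if w = n then 1 else if w = v then degN G v + 1 else degN G w := by
  have hadj : ∀ a b, (addEdge G n v).Adj a b ↔ G.Adj a b ∨ (a = n ∧ b = v) ∨ (a = v ∧ b = n) := by
    intro a b
    simp only [addEdge, SimpleGraph.sup_adj, SimpleGraph.fromEdgeSet_adj, Set.mem_singleton_iff,
      Sym2.eq_iff, ne_eq]
    constructor
    · tauto
    · rintro (h1 | h1 | h1)
      · exact Or.inl h1
      · exact Or.inr ⟨Or.inl h1, by omega⟩
      · exact Or.inr ⟨Or.inr h1, by omega⟩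
  have hn : ∀ b, ¬ G.Adj n b := fun b hb => lt_irrefl _ (h.adj_lt _ _ hb).1
  have hn' : ∀ b, ¬ G.Adj b n := fun b hb => lt_irrefl _ (h.adj_lt _ _ hb).2
  split_ifs with h1 h2
  · have : (addEdge G n v).neighborSet w = {v} := by
      ext b
      simp only [SimpleGraph.mem_neighborSet, hadj, Set.mem_singleton_iff, h1, hn, true_and,
        false_or]
      constructor
      · rintro (h | h) <;> omega
      · exact Or.inl
    simp [degN, this]
  · have : (addEdge G n v).neighborSet w = insert n (G.neighborSet v) := by
      ext b
      simp only [SimpleGraph.mem_neighborSet, hadj, Set.mem_insert_iff, h2, hv.ne, false_and,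
        true_and, false_or]
      exact or_comm
    have hmem : n ∉ G.neighborSet v := hn' v
    rw [degN, this, Set.ncard_insert_of_notMem hmem (h.finite_neighborSet v), degN]
  · have : (addEdge G n v).neighborSet w = G.neighborSet w := by
      ext b
      simp only [SimpleGraph.mem_neighborSet, hadj, h1, h2, false_and, or_false]
    rw [degN, this]
    rfl

/-- The sum of `f` over the degrees of the vertices `0, …, n-1`. -/
def degSum (f : ℕ → ℝ) (n : ℕ) (G : SimpleGraph ℕ) : ℝ := ∑ v ∈ Finset.range n, f (degN G v)

lemma TreeLike.degSum_addEdge {n : ℕ} {G : SimpleGraph ℕ} (h : TreeLike n G) {v : ℕ} (hv : v < n)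
    (f : ℕ → ℝ) :
    degSum f (n + 1) (addEdge G n v) =
      degSum f n G + f 1 + (f (degN G v + 1) - f (degN G v)) := by
  have key : ∀ w ∈ Finset.range n, f (degN (addEdge G n v) w) =
      f (degN G w) + if w = v then f (degN G v + 1) - f (degN G v) else 0 := by
    intro w hw
    have hw := Finset.mem_range.1 hw
    rw [h.degN_addEdge hv, if_neg hw.ne]
    split_ifs with h2
    · rw [h2]; ring
    · ring
  rw [degSum, Finset.sum_range_succ, Finset.sum_congr rfl key, Finset.sum_add_distrib,
    Finset.sum_ite_eq' _ _ _, if_pos (Finset.mem_range.2 hv), h.degN_addEdge hv, if_pos rfl, degSum]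
  ring

lemma TreeLike.degSum_id {n : ℕ} {G : SimpleGraph ℕ} (h : TreeLike n G) (hn : 2 ≤ n) :
    degSum (fun d => (d : ℝ)) n G = 2 * ((n : ℝ) - 1) := by
  have := congrArg (Nat.cast : ℕ → ℝ) h.sum_degN
  push_cast [Nat.cast_sub (show 1 ≤ n by omega)] at this
  exact this

lemma TreeLike.addEdge {n : ℕ} {G : SimpleGraph ℕ} (h : TreeLike n G) (hn : 2 ≤ n)
    {v : ℕ} (hv : v < n) : TreeLike (n + 1) (addEdge G n v) where
  adj_lt a b hab := by
    simp only [_root_.addEdge, SimpleGraph.sup_adj, SimpleGraph.fromEdgeSet_adj,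
      Set.mem_singleton_iff, Sym2.eq_iff] at hab
    rcases hab with hab | ⟨hab | hab, -⟩
    · have := h.adj_lt _ _ hab
      omega
    · omega
    · omega
  one_le_degN w hw := by
    rw [h.degN_addEdge hv]
    split_ifs
    · exact le_rfl
    · omega
    · exact h.one_le_degN w (by omega)
  sum_degN := by
    have h1 := h.degSum_addEdge hv fun d => (d : ℝ)
    rw [h.degSum_id hn] at h1
    have h2 : ((∑ w ∈ Finset.range (n + 1), degN (_root_.addEdge G n v) w : ℕ) : ℝ)
        = ((2 * n : ℕ) : ℝ) := by
      push_cast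
      rw [degSum] at h1
      rw [h1]
      push_cast
      ring
    exact_mod_cast h2

lemma IsTreeOn.treeLike {k : ℕ} {G : SimpleGraph ℕ} (h : IsTreeOn k G) (hk : 2 ≤ k) :
    TreeLike k G := by
  classical
  obtain ⟨hadj, htree⟩ := h
  let e : Fin k ≃ {v : ℕ | v < k} := Fin.equivSubtype
  let : Fintype {v : ℕ | v < k} := Fintype.ofEquiv _ e
  have hcard : Fintype.card {v : ℕ | v < k} = k := by
    rw [← Fintype.card_congr e, Fintype.card_fin]
  have hdeg : ∀ v : {v : ℕ | v < k}, (G.induce {v : ℕ | v < k}).degree v = degN G v := by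
    intro v
    have : Subtype.val '' ((G.induce {v : ℕ | v < k}).neighborSet v) = G.neighborSet v := by
      ext w
      simp only [Set.mem_image, SimpleGraph.mem_neighborSet, SimpleGraph.comap_adj,
        Function.Embedding.subtype_apply, Subtype.exists, exists_and_left, exists_prop,
        exists_eq_right_right]
      exact ⟨fun hh => hh.1, fun hh => ⟨hh, (hadj _ _ hh).2⟩⟩
    rw [degN, ← this, Set.ncard_image_of_injective _ Subtype.val_injective,
      Set.ncard_eq_toFinset_card', ← SimpleGraph.card_neighborFinset_eq_degree]
    congr 1
  refine ⟨hadj, fun v hv => ?_, ?_⟩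
  · have : Nontrivial {v : ℕ | v < k} := by
      rw [← Fintype.one_lt_card_iff_nontrivial, hcard]
      omega
    have := htree.connected.preconnected.degree_pos_of_nontrivial ⟨v, hv⟩
    rw [hdeg] at this
    exact this
  · have h1 := htree.card_edgeFinset
    have h2 := (G.induce {v : ℕ | v < k}).sum_degrees_eq_twice_card_edges
    rw [hcard] at h1
    have h3 : ∑ v ∈ Finset.range k, degN G v =
        ∑ v, (G.induce {v : ℕ | v < k}).degree v := by
      rw [Finset.sum_range, ← e.sum_comp]
      exact Finset.sum_congr rfl fun i _ => (hdeg (e i)).symm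
    rw [h3, h2]
    omega

/-- The expectation of `f` after one step of preferential attachment from `G`. -/
def stepMean (n : ℕ) (f : SimpleGraph ℕ → ℝ) (G : SimpleGraph ℕ) : ℝ :=
  ∑ v ∈ Finset.range n, (degN G v : ℝ) / (2 * ((n : ℝ) - 1)) * f (addEdge G n v)

/-- The expectation of `f` after `m` steps of preferential attachment from `T`. -/
def paMean (k : ℕ) (T : SimpleGraph ℕ) : ℕ → (SimpleGraph ℕ → ℝ) → ℝ
  | 0, f => f T
  | m + 1, f => paMean k T m (stepMean (k + m) f)

lemma stepMean_add (n : ℕ) (f g : SimpleGraph ℕ → ℝ) :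
    stepMean n (fun G => f G + g G) = fun G => stepMean n f G + stepMean n g G := by
  ext G
  simp only [stepMean, mul_add, Finset.sum_add_distrib]

lemma stepMean_const_mul (n : ℕ) (c : ℝ) (f : SimpleGraph ℕ → ℝ) :
    stepMean n (fun G => c * f G) = fun G => c * stepMean n f G := by
  ext G
  simp only [stepMean, Finset.mul_sum]
  exact Finset.sum_congr rfl fun _ _ => by ring

lemma TreeLike.sum_weights {n : ℕ} {G : SimpleGraph ℕ} (h : TreeLike n G) (hn : 2 ≤ n) :
    ∑ v ∈ Finset.range n, (degN G v : ℝ) / (2 * ((n : ℝ) - 1)) = 1 := by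
  have hn' : (2 : ℝ) ≤ n := by exact_mod_cast hn
  rw [← Finset.sum_div]
  have := h.degSum_id hn
  rw [degSum] at this
  rw [this]
  exact div_self (by linarith)

lemma weight_nonneg {n : ℕ} (G : SimpleGraph ℕ) (hn : 2 ≤ n) (v : ℕ) :
    0 ≤ (degN G v : ℝ) / (2 * ((n : ℝ) - 1)) := by
  have hn' : (2 : ℝ) ≤ n := by exact_mod_cast hn
  exact div_nonneg (Nat.cast_nonneg _) (by linarith)

lemma TreeLike.stepMean_const {n : ℕ} {G : SimpleGraph ℕ} (h : TreeLike n G) (hn : 2 ≤ n) (c : ℝ) :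
    stepMean n (fun _ => c) G = c := by
  rw [stepMean, ← Finset.sum_mul, h.sum_weights hn, one_mul]

lemma TreeLike.stepMean_mono {n : ℕ} {G : SimpleGraph ℕ} (h : TreeLike n G) (hn : 2 ≤ n)
    {f g : SimpleGraph ℕ → ℝ} (hfg : ∀ H, TreeLike (n + 1) H → f H ≤ g H) :
    stepMean n f G ≤ stepMean n g G :=
  Finset.sum_le_sum fun v hv => mul_le_mul_of_nonneg_left
    (hfg _ (h.addEdge hn (Finset.mem_range.1 hv))) (weight_nonneg G hn v)

lemma paMean_add (k : ℕ) (T : SimpleGraph ℕ) (m : ℕ) (f g : SimpleGraph ℕ → ℝ) :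
    paMean k T m (fun G => f G + g G) = paMean k T m f + paMean k T m g := by
  induction m generalizing f g with
  | zero => rfl
  | succ m ih => rw [paMean, stepMean_add, ih]; rfl

lemma paMean_const_mul (k : ℕ) (T : SimpleGraph ℕ) (m : ℕ) (c : ℝ) (f : SimpleGraph ℕ → ℝ) :
    paMean k T m (fun G => c * f G) = c * paMean k T m f := by
  induction m generalizing f with
  | zero => rfl
  | succ m ih => rw [paMean, stepMean_const_mul, ih]; rfl

lemma paMean_zero (k : ℕ) (T : SimpleGraph ℕ) (m : ℕ) : paMean k T m (fun _ => 0) = 0 := by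
  simpa using paMean_const_mul k T m 0 fun _ => 0

lemma paMean_sum {ι : Type*} (k : ℕ) (T : SimpleGraph ℕ) (m : ℕ) (s : Finset ι)
    (f : ι → SimpleGraph ℕ → ℝ) :
    paMean k T m (fun G => ∑ i ∈ s, f i G) = ∑ i ∈ s, paMean k T m (f i) := by
  classical
  induction s using Finset.induction_on with
  | empty => simpa using paMean_zero k T m
  | insert a s ha ih =>
    simp only [Finset.sum_insert ha]
    rw [paMean_add, ih]

section

variable {k : ℕ} {T : SimpleGraph ℕ}

lemma paMean_mono (hT : TreeLike k T) (hk : 2 ≤ k) {m : ℕ} {f g : SimpleGraph ℕ → ℝ}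
    (hfg : ∀ G, TreeLike (k + m) G → f G ≤ g G) : paMean k T m f ≤ paMean k T m g := by
  induction m generalizing f g with
  | zero => exact hfg T hT
  | succ m ih => exact ih fun G hG => hG.stepMean_mono (by omega) hfg

lemma paMean_congr (hT : TreeLike k T) (hk : 2 ≤ k) {m : ℕ} {f g : SimpleGraph ℕ → ℝ}
    (hfg : ∀ G, TreeLike (k + m) G → f G = g G) : paMean k T m f = paMean k T m g :=
  le_antisymm (paMean_mono hT hk fun G hG => (hfg G hG).le)
    (paMean_mono hT hk fun G hG => (hfg G hG).ge)

lemma paMean_const (hT : TreeLike k T) (hk : 2 ≤ k) (m : ℕ) (c : ℝ) :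
    paMean k T m (fun _ => c) = c := by
  induction m with
  | zero => rfl
  | succ m ih =>
    rw [paMean]
    exact (paMean_congr hT hk fun G hG => hG.stepMean_const (by omega) c).trans ih

lemma lintegral_paStep (n : ℕ) (G : SimpleGraph ℕ) (F : SimpleGraph ℕ → ℝ≥0∞) :
    ∫⁻ H, F H ∂(paStep n G) =
      ∑' v, (degN G v : ℝ≥0∞) / ((2 * (n - 1) : ℕ) : ℝ≥0∞) * F (addEdge G n v) := by
  rw [paStep, lintegral_sum_measure]
  refine tsum_congr fun v => ?_
  rw [lintegral_smul_measure, lintegral_dirac' _ measurable_from_top, smul_eq_mul]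

lemma TreeLike.lintegral_paStep {n : ℕ} {G : SimpleGraph ℕ} (h : TreeLike n G) (hn : 2 ≤ n)
    {F : SimpleGraph ℕ → ℝ≥0∞} {f : SimpleGraph ℕ → ℝ}
    (hF : ∀ H, TreeLike (n + 1) H → F H = ENNReal.ofReal (f H) ∧ 0 ≤ f H) :
    ∫⁻ H, F H ∂(paStep n G) = ENNReal.ofReal (stepMean n f G) := by
  rw [_root_.lintegral_paStep, tsum_eq_sum (s := Finset.range n), stepMean,
    ENNReal.ofReal_sum_of_nonneg]
  · refine Finset.sum_congr rfl fun v hv => ?_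
    have hv' := hF _ (h.addEdge hn (Finset.mem_range.1 hv))
    have hpos : (0 : ℝ) < ((2 * (n - 1) : ℕ) : ℝ) := by
      have : 0 < 2 * (n - 1) := by omega
      exact_mod_cast this
    have hc : 2 * ((n : ℝ) - 1) = ((2 * (n - 1) : ℕ) : ℝ) := by
      push_cast [Nat.cast_sub (show 1 ≤ n by omega)]
      rfl
    rw [ENNReal.ofReal_mul (weight_nonneg G hn v), hv'.1, hc, ENNReal.ofReal_div_of_pos hpos,
      ENNReal.ofReal_natCast, ENNReal.ofReal_natCast]
  · exact fun v hv => mul_nonneg (weight_nonneg G hn v)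
      (hF _ (h.addEdge hn (Finset.mem_range.1 hv))).2
  · intro v hv
    rw [h.degN_eq_zero (by simpa using hv)]
    simp

lemma lintegral_PAlawAux (hT : TreeLike k T) (hk : 2 ≤ k) {m : ℕ} {F : SimpleGraph ℕ → ℝ≥0∞}
    {f : SimpleGraph ℕ → ℝ}
    (hF : ∀ G, TreeLike (k + m) G → F G = ENNReal.ofReal (f G) ∧ 0 ≤ f G) :
    ∫⁻ G, F G ∂(PAlawAux k T m) = ENNReal.ofReal (paMean k T m f) := by
  induction m generalizing F f with
  | zero =>
    rw [PAlawAux, lintegral_dirac' _ measurable_from_top]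
    exact (hF T hT).1
  | succ m ih =>
    rw [PAlawAux, Measure.lintegral_bind measurable_from_top.aemeasurable
      measurable_from_top.aemeasurable, paMean]
    refine ih fun G hG => ⟨hG.lintegral_paStep (by omega) hF, ?_⟩
    exact Finset.sum_nonneg fun v hv => mul_nonneg (weight_nonneg G (by omega) v)
      (hF _ (hG.addEdge (by omega) (Finset.mem_range.1 hv))).2

end

section

variable {α : Type*} [MeasurableSpace α]

lemma tvDist_comm (μ ν : Measure α) : tvDist μ ν = tvDist ν μ := by
  simp only [tvDist, abs_sub_comm]

lemma abs_measure_toReal_sub_le (μ ν : Measure α) [IsProbabilityMeasure μ]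
    [IsProbabilityMeasure ν] (A : Set α) : |(μ A).toReal - (ν A).toReal| ≤ 1 := by
  have h1 : (μ A).toReal ≤ 1 := measureReal_le_one
  have h2 : (ν A).toReal ≤ 1 := measureReal_le_one
  have h3 : 0 ≤ (μ A).toReal := ENNReal.toReal_nonneg
  have h4 : 0 ≤ (ν A).toReal := ENNReal.toReal_nonneg
  rw [abs_le]
  constructor <;> linarith

lemma tvDist_le_one (μ ν : Measure α) [IsProbabilityMeasure μ] [IsProbabilityMeasure ν] :
    tvDist μ ν ≤ 1 :=
  ciSup_le fun A => abs_measure_toReal_sub_le μ ν A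

lemma tvDist_nonneg (μ ν : Measure α) : 0 ≤ tvDist μ ν :=
  Real.iSup_nonneg fun _ => abs_nonneg _

lemma measure_le_add_tvDist (μ ν : Measure α) [IsProbabilityMeasure μ] [IsProbabilityMeasure ν]
    (A : Set α) : μ A ≤ ν A + ENNReal.ofReal (tvDist μ ν) := by
  have h1 : |(μ A).toReal - (ν A).toReal| ≤ tvDist μ ν :=
    le_ciSup (f := fun A : Set α => |(μ A).toReal - (ν A).toReal|)
      ⟨1, by rintro _ ⟨B, rfl⟩; exact abs_measure_toReal_sub_le μ ν B⟩ A
  have h2 := (le_abs_self _).trans h1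
  rw [← ENNReal.ofReal_toReal (measure_ne_top μ A), ← ENNReal.ofReal_toReal (measure_ne_top ν A),
    ← ENNReal.ofReal_add ENNReal.toReal_nonneg (tvDist_nonneg μ ν)]
  exact ENNReal.ofReal_le_ofReal (by linarith)

lemma lintegral_min_le_add_tvDist (μ ν : Measure α) [IsProbabilityMeasure μ]
    [IsProbabilityMeasure ν] {f : α → ℝ} (hf : Measurable f) (hf0 : ∀ x, 0 ≤ f x) {L : ℝ}
    (hL : 0 ≤ L) :
    ∫⁻ x, ENNReal.ofReal (min (f x) L) ∂μ ≤
      ∫⁻ x, ENNReal.ofReal (min (f x) L) ∂ν + ENNReal.ofReal (L * tvDist μ ν) := by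
  have hm : Measurable fun x => min (f x) L := hf.min measurable_const
  have h0 : ∀ x, 0 ≤ min (f x) L := fun x => le_min (hf0 x) hL
  rw [lintegral_eq_lintegral_meas_lt μ (Eventually.of_forall h0) hm.aemeasurable,
    lintegral_eq_lintegral_meas_lt ν (Eventually.of_forall h0) hm.aemeasurable]
  have hconst : ∫⁻ t in Set.Ioi (0 : ℝ),
      (Set.Iic L).indicator (fun _ => ENNReal.ofReal (tvDist μ ν)) t =
        ENNReal.ofReal (L * tvDist μ ν) := by
    rw [lintegral_indicator measurableSet_Iic, Measure.restrict_restrict measurableSet_Iic,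
      setLIntegral_const, Set.Iic_inter_Ioi, Real.volume_Ioc, sub_zero, mul_comm,
      ENNReal.ofReal_mul hL]
  rw [← hconst, ← lintegral_add_right _ (measurable_const.indicator measurableSet_Iic)]
  refine lintegral_mono fun t => ?_
  by_cases ht : t ≤ L
  · simpa [ht] using measure_le_add_tvDist μ ν {x | t < min (f x) L}
  · have : {x | t < min (f x) L} = ∅ := by
      ext x
      simp only [lt_min_iff, Set.mem_ofPred_eq, Set.mem_empty_iff_false, iff_false]
      exact fun h => ht h.2.le
    beta_reduce
    rw [this]
    simp

lemma sub_le_mul_tvDist (μ ν : Measure α) [IsProbabilityMeasure μ] [IsProbabilityMeasure ν]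
    {f : α → ℝ} (hf : Measurable f) (hf0 : ∀ x, 0 ≤ f x) {L A B M : ℝ} (hL : 0 < L)
    (hB : 0 ≤ B) (hM : 0 ≤ M)
    (hμ : ENNReal.ofReal A ≤ ∫⁻ x, ENNReal.ofReal (f x) ∂μ)
    (hν : ∫⁻ x, ENNReal.ofReal (f x) ∂ν ≤ ENNReal.ofReal B)
    (hμ2 : ∫⁻ x, ENNReal.ofReal (f x ^ 2) ∂μ ≤ ENNReal.ofReal M) :
    A - B ≤ L * tvDist μ ν + M / L := by
  have hL2 : 0 ≤ L * tvDist μ ν := mul_nonneg hL.le (tvDist_nonneg μ ν)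
  have hML : 0 ≤ M / L := div_nonneg hM hL.le
  have h1 : ∫⁻ x, ENNReal.ofReal (f x) ∂μ ≤ ∫⁻ x, ENNReal.ofReal (min (f x) L) ∂μ +
      ENNReal.ofReal (1 / L) * ∫⁻ x, ENNReal.ofReal (f x ^ 2) ∂μ := by
    rw [← lintegral_const_mul _ (hf.pow_const 2).ennreal_ofReal, ← lintegral_add_left
      (hf.min measurable_const).ennreal_ofReal]
    refine lintegral_mono fun x => ?_
    rw [← ENNReal.ofReal_mul (by positivity), ← ENNReal.ofReal_add (le_min (hf0 x) hL.le)
      (by positivity)]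
    refine ENNReal.ofReal_le_ofReal ?_
    rcases le_total (f x) L with h | h
    · rw [min_eq_left h]
      have : 0 ≤ 1 / L * f x ^ 2 := by positivity
      linarith
    · rw [min_eq_right h]
      have : f x ≤ 1 / L * f x ^ 2 := by
        rw [one_div, inv_mul_eq_div, le_div_iff₀ hL]
        nlinarith [hf0 x]
      linarith
  have h2 : ∫⁻ x, ENNReal.ofReal (min (f x) L) ∂ν ≤ ENNReal.ofReal B :=
    (lintegral_mono fun x => ENNReal.ofReal_le_ofReal (min_le_left _ _)).trans hν
  have h3 : ENNReal.ofReal A ≤ ENNReal.ofReal (B + L * tvDist μ ν + M / L) := by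
    rw [ENNReal.ofReal_add (add_nonneg hB hL2) hML, ENNReal.ofReal_add hB hL2]
    refine hμ.trans (h1.trans (add_le_add ((lintegral_min_le_add_tvDist μ ν hf hf0 hL.le).trans
      (add_le_add_left h2 _)) ?_))
    calc _ ≤ ENNReal.ofReal (1 / L) * ENNReal.ofReal M := by gcongr
      _ = ENNReal.ofReal (M / L) := by
        rw [← ENNReal.ofReal_mul (by positivity), one_div, inv_mul_eq_div]
  have h4 := (ENNReal.ofReal_le_ofReal_iff (by positivity)).1 h3
  linarith

end

/-- The rising factorial `d (d+1) ⋯ (d+p-1)` as a real number. -/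
def risingFac (p d : ℕ) : ℝ := (d.ascFactorial p : ℝ)

lemma risingFac_nonneg (p d : ℕ) : 0 ≤ risingFac p d := Nat.cast_nonneg _

lemma risingFac_zero (q : ℕ) : risingFac (q + 1) 0 = 0 := by
  simp [risingFac, Nat.zero_ascFactorial]

lemma risingFac_one (p : ℕ) : risingFac p 1 = (p.factorial : ℝ) := by
  simp [risingFac, Nat.one_ascFactorial]

lemma mul_risingFac_succ (p d : ℕ) :
    (d : ℝ) * risingFac p (d + 1) = ((d : ℝ) + p) * risingFac p d := by
  have := congrArg (Nat.cast : ℕ → ℝ) (Nat.succ_ascFactorial d p)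
  push_cast at this
  exact this

lemma mul_risingFac_succ_sub (p d : ℕ) :
    (d : ℝ) * (risingFac p (d + 1) - risingFac p d) = p * risingFac p d := by
  rw [mul_sub, mul_risingFac_succ]
  ring

lemma mul_sq_risingFac_succ_sub_le (q : ℕ) {d : ℕ} (hd : 1 ≤ d) :
    (d : ℝ) * (risingFac (q + 1) (d + 1) - risingFac (q + 1) d) ^ 2 ≤
      ((q : ℝ) + 1) ^ 2 * risingFac (2 * q + 1) d := by
  have hd0 : (0 : ℝ) < d := by exact_mod_cast hd
  have h1 : risingFac (q + 1) d = d * risingFac q (d + 1) := by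
    have := Nat.ascFactorial_mul_ascFactorial d 1 q
    rw [add_comm 1 q] at this
    simp only [risingFac]
    rw [← this]
    simp [Nat.ascFactorial_succ]
  have h2 : risingFac (2 * q + 1) d = risingFac (q + 1) d * risingFac q (d + (q + 1)) := by
    have := Nat.ascFactorial_mul_ascFactorial d (q + 1) q
    rw [show q + 1 + q = 2 * q + 1 by ring] at this
    simp only [risingFac]
    rw [← this]
    push_cast
    rfl
  have h3 : risingFac q (d + 1) ≤ risingFac q (d + (q + 1)) := by
    exact Nat.cast_le.2 (Nat.ascFactorial_le q (by omega))
  have h4 : risingFac (q + 1) (d + 1) - risingFac (q + 1) d =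
      ((q : ℝ) + 1) * risingFac q (d + 1) := by
    have := mul_risingFac_succ_sub (q + 1) d
    rw [h1] at this ⊢
    push_cast at this
    apply mul_left_cancel₀ hd0.ne'
    linarith
  rw [h4, h2, h1]
  have h5 := risingFac_nonneg q (d + 1)
  calc (d : ℝ) * (((q : ℝ) + 1) * risingFac q (d + 1)) ^ 2
      = ((q : ℝ) + 1) ^ 2 * (d * risingFac q (d + 1) * risingFac q (d + 1)) := by ring
    _ ≤ _ := by gcongr

lemma degSum_nonneg {f : ℕ → ℝ} (hf : ∀ d, 0 ≤ f d) (n : ℕ) (G : SimpleGraph ℕ) :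
    0 ≤ degSum f n G := Finset.sum_nonneg fun _ _ => hf _

/-- One step of preferential attachment changes the mean of `degSum f` linearly. -/
lemma TreeLike.stepMean_degSum {n : ℕ} {G : SimpleGraph ℕ} (h : TreeLike n G) (hn : 2 ≤ n)
    (f : ℕ → ℝ) :
    stepMean n (degSum f (n + 1)) G =
      degSum f n G + f 1 +
        degSum (fun d => d * (f (d + 1) - f d)) n G / (2 * ((n : ℝ) - 1)) := by
  have hw := h.sum_weights hn
  have : ∀ v ∈ Finset.range n,
      (degN G v : ℝ) / (2 * ((n : ℝ) - 1)) * degSum f (n + 1) (_root_.addEdge G n v) =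
        (degN G v : ℝ) / (2 * ((n : ℝ) - 1)) * (degSum f n G + f 1) +
        degN G v * (f (degN G v + 1) - f (degN G v)) / (2 * ((n : ℝ) - 1)) := by
    intro v hv
    rw [h.degSum_addEdge (Finset.mem_range.1 hv)]
    ring
  rw [stepMean, Finset.sum_congr rfl this, Finset.sum_add_distrib, ← Finset.sum_mul, hw, one_mul,
    ← Finset.sum_div]
  rfl

/-- The drift coefficient that turns rising factorial moments into a martingale. -/
def driftCoeff (q : ℕ) : ℝ := 2 * ((q + 1).factorial : ℝ) / ((q : ℝ) - 1)

lemma driftCoeff_pos {q : ℕ} (hq : 2 ≤ q) : 0 < driftCoeff q := by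
  have hq' : (2 : ℝ) ≤ q := by exact_mod_cast hq
  have : (0 : ℝ) < (q + 1).factorial := by exact_mod_cast Nat.factorial_pos _
  exact div_pos (by linarith) (by linarith)

/-- The rising factorial moment of order `q + 1` of the degrees, with a drift correction. -/
def degMoment (q n : ℕ) (G : SimpleGraph ℕ) : ℝ :=
  degSum (risingFac (q + 1)) n G + driftCoeff q * ((n : ℝ) - 1)

/-- The growth factor of the mean of `degMoment q` from `n` to `n + 1` vertices. -/
def growth (q n : ℕ) : ℝ := 1 + ((q : ℝ) + 1) / (2 * ((n : ℝ) - 1))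

lemma one_le_growth (q : ℕ) {n : ℕ} (hn : 2 ≤ n) : 1 ≤ growth q n := by
  have hn' : (2 : ℝ) ≤ n := by exact_mod_cast hn
  have : 0 ≤ ((q : ℝ) + 1) / (2 * ((n : ℝ) - 1)) := div_nonneg (by positivity) (by linarith)
  rw [growth]
  linarith

lemma driftCoeff_mul_le_degMoment (q n : ℕ) (G : SimpleGraph ℕ) :
    driftCoeff q * ((n : ℝ) - 1) ≤ degMoment q n G := by
  have := degSum_nonneg (risingFac_nonneg (q + 1)) n G
  rw [degMoment]
  linarith

lemma degSum_le_degMoment {q n : ℕ} (hq : 2 ≤ q) (hn : 2 ≤ n) (G : SimpleGraph ℕ) :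
    degSum (risingFac (q + 1)) n G ≤ degMoment q n G := by
  have hn' : (2 : ℝ) ≤ n := by exact_mod_cast hn
  have : 0 ≤ driftCoeff q * ((n : ℝ) - 1) := mul_nonneg (driftCoeff_pos hq).le (by linarith)
  rw [degMoment]
  linarith

lemma degMoment_nonneg {q n : ℕ} (hq : 2 ≤ q) (hn : 2 ≤ n) (G : SimpleGraph ℕ) :
    0 ≤ degMoment q n G :=
  (degSum_nonneg (risingFac_nonneg (q + 1)) n G).trans (degSum_le_degMoment hq hn G)

lemma TreeLike.stepMean_degMoment {n : ℕ} {G : SimpleGraph ℕ} (h : TreeLike n G) (hn : 2 ≤ n)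
    {q : ℕ} (hq : 2 ≤ q) :
    stepMean n (degMoment q (n + 1)) G = growth q n * degMoment q n G := by
  have hn' : (2 : ℝ) ≤ n := by exact_mod_cast hn
  have hq' : (2 : ℝ) ≤ q := by exact_mod_cast hq
  have hn0 : (n : ℝ) - 1 ≠ 0 := by linarith
  have hq0 : (q : ℝ) - 1 ≠ 0 := by linarith
  have h1 : stepMean n (degMoment q (n + 1)) G =
      stepMean n (degSum (risingFac (q + 1)) (n + 1)) G + driftCoeff q * n := by
    have h2 := h.stepMean_const hn (driftCoeff q * (((n + 1 : ℕ) : ℝ) - 1))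
    have := congrFun (stepMean_add n (degSum (risingFac (q + 1)) (n + 1))
      fun _ => driftCoeff q * (((n + 1 : ℕ) : ℝ) - 1)) G
    rw [h2] at this
    refine this.trans ?_
    push_cast
    ring
  have h3 : degSum (fun d => (d : ℝ) * (risingFac (q + 1) (d + 1) - risingFac (q + 1) d)) n G =
      ((q : ℝ) + 1) * degSum (risingFac (q + 1)) n G := by
    simp only [degSum, mul_risingFac_succ_sub, Finset.mul_sum]
    push_cast
    rfl
  rw [h1, h.stepMean_degSum hn, h3, risingFac_one, degMoment, growth]
  have h4 : ((q + 1).factorial : ℝ) = driftCoeff q * ((q : ℝ) - 1) / 2 := by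
    rw [driftCoeff]
    field_simp
  rw [h4]
  field_simp
  ring

/-- The weight of the second term in `lyapunov`. -/
def lyapunovCoeff (q : ℕ) : ℝ :=
  2 * ((q : ℝ) + 1) ^ 2 + 4 * (((q + 1).factorial : ℝ) + driftCoeff q) ^ 2 / driftCoeff (2 * q)

/-- A function dominating `degMoment q ^ 2` whose mean grows at most like the square of the mean of
`degMoment q`. -/
def lyapunov (q n : ℕ) (G : SimpleGraph ℕ) : ℝ :=
  degMoment q n G ^ 2 + lyapunovCoeff q * degMoment (2 * q) n G

lemma lyapunovCoeff_nonneg {q : ℕ} (hq : 2 ≤ q) : 0 ≤ lyapunovCoeff q := by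
  have := driftCoeff_pos (show 2 ≤ 2 * q by omega)
  rw [lyapunovCoeff]
  positivity

lemma sq_degMoment_le_lyapunov {q n : ℕ} (hq : 2 ≤ q) (hn : 2 ≤ n) (G : SimpleGraph ℕ) :
    degMoment q n G ^ 2 ≤ lyapunov q n G := by
  have := mul_nonneg (lyapunovCoeff_nonneg hq) (degMoment_nonneg (show 2 ≤ 2 * q by omega) hn G)
  rw [lyapunov]
  linarith

lemma TreeLike.stepMean_sq_degMoment_le {n : ℕ} {G : SimpleGraph ℕ} (h : TreeLike n G)
    (hn : 2 ≤ n) {q : ℕ} (hq : 2 ≤ q) :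
    stepMean n (fun H => degMoment q (n + 1) H ^ 2) G ≤
      (2 * growth q n - 1) * degMoment q n G ^ 2 +
        2 * (((q + 1).factorial : ℝ) + driftCoeff q) ^ 2 +
        2 * (((q : ℝ) + 1) ^ 2 * degMoment (2 * q) n G / (2 * ((n : ℝ) - 1))) := by
  have hn' : (2 : ℝ) ≤ n := by exact_mod_cast hn
  set W := degMoment q n G with hW
  set c := ((q + 1).factorial : ℝ) + driftCoeff q with hc
  have hinc : ∀ v ∈ Finset.range n, degMoment q (n + 1) (_root_.addEdge G n v) =
      W + (c + (risingFac (q + 1) (degN G v + 1) - risingFac (q + 1) (degN G v))) := by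
    intro v hv
    rw [degMoment, h.degSum_addEdge (Finset.mem_range.1 hv), risingFac_one, hW, degMoment, hc]
    push_cast
    ring
  have hmean := h.stepMean_degMoment hn hq
  have hsum := h.sum_weights hn
  rw [stepMean] at hmean ⊢
  have hterm : ∀ v ∈ Finset.range n,
      (degN G v : ℝ) / (2 * ((n : ℝ) - 1)) * degMoment q (n + 1) (_root_.addEdge G n v) ^ 2 ≤
      (degN G v : ℝ) / (2 * ((n : ℝ) - 1)) * (2 * c ^ 2 - W ^ 2) +
      2 * W * ((degN G v : ℝ) / (2 * ((n : ℝ) - 1)) *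
        degMoment q (n + 1) (_root_.addEdge G n v)) +
      2 * (((q : ℝ) + 1) ^ 2 * risingFac (2 * q + 1) (degN G v) / (2 * ((n : ℝ) - 1))) := by
    intro v hv
    have hx := weight_nonneg G hn v
    have h1 := mul_sq_risingFac_succ_sub_le q (h.one_le_degN v (Finset.mem_range.1 hv))
    have h2 := div_le_div_of_nonneg_right h1 (show 0 ≤ 2 * ((n : ℝ) - 1) by linarith)
    rw [mul_div_right_comm] at h2
    rw [hinc v hv]
    set δ := risingFac (q + 1) (degN G v + 1) - risingFac (q + 1) (degN G v)
    set x := (degN G v : ℝ) / (2 * ((n : ℝ) - 1))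
    nlinarith [mul_nonneg hx (sq_nonneg (c - δ))]
  refine (Finset.sum_le_sum hterm).trans ?_
  rw [Finset.sum_add_distrib, Finset.sum_add_distrib, ← Finset.sum_mul, hsum, ← Finset.mul_sum,
    hmean, ← Finset.mul_sum, ← Finset.sum_div, ← Finset.mul_sum]
  have h3 : ∑ v ∈ Finset.range n, risingFac (2 * q + 1) (degN G v) ≤ degMoment (2 * q) n G :=
    degSum_le_degMoment (by omega) hn G
  have h4 : ((q : ℝ) + 1) ^ 2 * ∑ v ∈ Finset.range n, risingFac (2 * q + 1) (degN G v) /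
      (2 * ((n : ℝ) - 1)) ≤ ((q : ℝ) + 1) ^ 2 * (degMoment (2 * q) n G / (2 * ((n : ℝ) - 1))) := by
    rw [← Finset.sum_div]
    have : 0 ≤ 2 * ((n : ℝ) - 1) := by linarith
    gcongr
  rw [← Finset.sum_div, ← mul_div_assoc, ← mul_div_assoc] at h4
  linarith

lemma TreeLike.stepMean_lyapunov_le {n : ℕ} {G : SimpleGraph ℕ} (h : TreeLike n G) (hn : 2 ≤ n)
    {q : ℕ} (hq : 2 ≤ q) :
    stepMean n (lyapunov q (n + 1)) G ≤ growth q n ^ 2 * lyapunov q n G := by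
  have hn' : (2 : ℝ) ≤ n := by exact_mod_cast hn
  have h1 := h.stepMean_sq_degMoment_le hn hq
  have h2 := h.stepMean_degMoment hn (show 2 ≤ 2 * q by omega)
  have h3 : stepMean n (lyapunov q (n + 1)) G =
      stepMean n (fun H => degMoment q (n + 1) H ^ 2) G +
        lyapunovCoeff q * (growth (2 * q) n * degMoment (2 * q) n G) := by
    have := congrFun (stepMean_add n (fun H => degMoment q (n + 1) H ^ 2)
      fun H => lyapunovCoeff q * degMoment (2 * q) (n + 1) H) G
    rw [stepMean_const_mul] at this
    beta_reduce at this
    rw [h2] at this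
    exact this
  have hβ := driftCoeff_pos (show 2 ≤ 2 * q by omega)
  have h4 := driftCoeff_mul_le_degMoment (2 * q) n G
  have hV : 0 ≤ lyapunov q n G := (sq_nonneg _).trans (sq_degMoment_le_lyapunov hq hn G)
  have hC := lyapunovCoeff_nonneg hq
  set M := degMoment (2 * q) n G
  set W := degMoment q n G with hW
  set c := ((q + 1).factorial : ℝ) + driftCoeff q with hc
  set x := 1 / (2 * ((n : ℝ) - 1)) with hx
  have hx0 : 0 < x := one_div_pos.2 (by linarith)
  have hg1 : growth q n = 1 + (q + 1) * x := by rw [growth, hx]; ring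
  have hg2 : growth (2 * q) n = 1 + (2 * q + 1) * x := by rw [growth, hx]; push_cast; ring
  have h5 : driftCoeff (2 * q) / 2 ≤ x * M := by
    have := mul_le_mul_of_nonneg_left h4 hx0.le
    have hxn : x * (driftCoeff (2 * q) * ((n : ℝ) - 1)) = driftCoeff (2 * q) / 2 := by
      rw [hx]
      have : (n : ℝ) - 1 ≠ 0 := by linarith
      field_simp
    linarith
  have h6 : 2 * c ^ 2 ≤ 4 * c ^ 2 / driftCoeff (2 * q) * (x * M) := by
    calc 2 * c ^ 2 = 4 * c ^ 2 / driftCoeff (2 * q) * (driftCoeff (2 * q) / 2) := by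
          field_simp; ring
      _ ≤ _ := by gcongr
  have h7 : lyapunovCoeff q * (x * M) =
      2 * ((q + 1) ^ 2 * (x * M)) + 4 * c ^ 2 / driftCoeff (2 * q) * (x * M) := by
    rw [lyapunovCoeff]; ring
  have h8 : ((q : ℝ) + 1) ^ 2 * M / (2 * ((n : ℝ) - 1)) = (q + 1) ^ 2 * (x * M) := by
    rw [hx]; ring
  rw [h8] at h1
  have h9 : stepMean n (lyapunov q (n + 1)) G ≤ (2 * growth q n - 1) * lyapunov q n G := by
    rw [h3, lyapunov, hg2]
    rw [hg1] at h1 ⊢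
    nlinarith
  refine h9.trans (mul_le_mul_of_nonneg_right ?_ hV)
  nlinarith [sq_nonneg (growth q n - 1)]

lemma degN_iso {G H : SimpleGraph ℕ} (e : G ≃g H) (v : ℕ) : degN H (e v) = degN G v :=
  (Nat.card_congr (e.mapNeighborSet v)).symm

/-- The isomorphism-invariant version of `degMoment`. -/
def typeMoment (q n : ℕ) : GraphType → ℝ :=
  Quotient.lift
    (fun G => ∑ᶠ v, risingFac (q + 1) (degN G v) + driftCoeff q * ((n : ℝ) - 1))
    fun G H ⟨e⟩ => by
      have : ∑ᶠ v, risingFac (q + 1) (degN G v) = ∑ᶠ v, risingFac (q + 1) (degN H v) := by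
        rw [← finsum_comp_equiv e.toEquiv (f := fun v => risingFac (q + 1) (degN H v))]
        exact finsum_congr fun v => congrArg _ (degN_iso e v).symm
      simp only [this]

lemma TreeLike.typeMoment_mk {n : ℕ} {G : SimpleGraph ℕ} (h : TreeLike n G) (q : ℕ) :
    typeMoment q n (Quotient.mk graphSetoid G) = degMoment q n G := by
  change ∑ᶠ v, risingFac (q + 1) (degN G v) + driftCoeff q * ((n : ℝ) - 1) = _
  rw [degMoment, degSum, finsum_eq_sum_of_support_subset]
  intro v hv
  by_contra hvn
  refine hv ?_
  change risingFac (q + 1) (degN G v) = 0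
  rw [h.degN_eq_zero (by simpa using hvn), risingFac_zero]

lemma typeMoment_nonneg {q n : ℕ} (hq : 2 ≤ q) (hn : 2 ≤ n) (x : GraphType) :
    0 ≤ typeMoment q n x := by
  induction x using Quotient.inductionOn with
  | h G =>
    have hn' : (2 : ℝ) ≤ n := by exact_mod_cast hn
    exact add_nonneg (finsum_nonneg fun v => risingFac_nonneg _ _)
      (mul_nonneg (driftCoeff_pos hq).le (by linarith))

section

variable {k : ℕ} {T : SimpleGraph ℕ}

lemma lintegral_PAtype (hT : TreeLike k T) (hk : 2 ≤ k) {m n : ℕ} (hn : k + m = n)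
    {F : GraphType → ℝ≥0∞} {f : SimpleGraph ℕ → ℝ}
    (hF : ∀ G, TreeLike n G → F (Quotient.mk graphSetoid G) = ENNReal.ofReal (f G) ∧ 0 ≤ f G) :
    ∫⁻ x, F x ∂(PAtype k T n) = ENNReal.ofReal (paMean k T m f) := by
  subst hn
  have hmap : ∫⁻ x, F x ∂(PAtype k T (k + m)) =
      ∫⁻ G, F (Quotient.mk graphSetoid G) ∂(PAlaw k T (k + m)) :=
    lintegral_map measurable_from_top measurable_from_top
  rw [hmap, PAlaw, Nat.add_sub_cancel_left]
  exact lintegral_PAlawAux hT hk hF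

lemma isProbabilityMeasure_PAtype (hT : TreeLike k T) (hk : 2 ≤ k) {m n : ℕ} (hn : k + m = n) :
    IsProbabilityMeasure (PAtype k T n) where
  measure_univ := by
    have := lintegral_PAtype hT hk hn (F := fun _ => 1) (f := fun _ => 1) (by simp)
    rw [paMean_const hT hk] at this
    simpa using this

/-- The growth factor of the mean of `degMoment q` from `n` to `n + i` vertices. -/
def totalGrowth (q n i : ℕ) : ℝ := ∏ j ∈ Finset.range i, growth q (n + j)

lemma totalGrowth_pos (q : ℕ) {n : ℕ} (hn : 2 ≤ n) (i : ℕ) : 0 < totalGrowth q n i :=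
  Finset.prod_pos fun j _ => zero_lt_one.trans_le (one_le_growth q (by omega))

lemma totalGrowth_succ (q n i : ℕ) :
    totalGrowth q n (i + 1) = totalGrowth q n i * growth q (n + i) :=
  Finset.prod_range_succ _ _

lemma paMean_degMoment (hT : TreeLike k T) (hk : 2 ≤ k) {q : ℕ} (hq : 2 ≤ q) {m n : ℕ}
    (hn : k + m = n) (i : ℕ) :
    paMean k T (m + i) (degMoment q (n + i)) =
      totalGrowth q n i * paMean k T m (degMoment q n) := by
  subst hn
  induction i with
  | zero => simp [totalGrowth]
  | succ i ih =>
    have : paMean k T (m + (i + 1)) (degMoment q (k + m + (i + 1))) =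
        paMean k T (m + i) (fun G => growth q (k + m + i) * degMoment q (k + m + i) G) :=
      paMean_congr hT hk (m := m + i) (f := stepMean (k + (m + i)) _) fun G hG => by
        rw [← add_assoc k m i] at hG ⊢
        exact hG.stepMean_degMoment (by omega) hq
    rw [this, paMean_const_mul, ih, totalGrowth_succ]
    ring

lemma paMean_lyapunov_le (hT : TreeLike k T) (hk : 2 ≤ k) {q : ℕ} (hq : 2 ≤ q) {m n : ℕ}
    (hn : k + m = n) (i : ℕ) :
    paMean k T (m + i) (lyapunov q (n + i)) ≤
      totalGrowth q n i ^ 2 * paMean k T m (lyapunov q n) := by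
  subst hn
  induction i with
  | zero => simp [totalGrowth]
  | succ i ih =>
    have : paMean k T (m + (i + 1)) (lyapunov q (k + m + (i + 1))) ≤
        paMean k T (m + i) (fun G => growth q (k + m + i) ^ 2 * lyapunov q (k + m + i) G) :=
      paMean_mono hT hk (m := m + i) (f := stepMean (k + (m + i)) _) fun G hG => by
        rw [← add_assoc k m i] at hG ⊢
        exact hG.stepMean_lyapunov_le (by omega) hq
    refine this.trans ?_
    rw [paMean_const_mul, totalGrowth_succ]
    calc _ ≤ growth q (k + m + i) ^ 2 *
          (totalGrowth q (k + m) i ^ 2 * paMean k T m (lyapunov q (k + m))) := by gcongr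
      _ = _ := by ring

end

lemma exists_le_tvDist_of_lt {k l : ℕ} {S T : SimpleGraph ℕ} (hS : TreeLike k S)
    (hT : TreeLike l T) (hk : 2 ≤ k) (hl : 2 ≤ l) {q : ℕ} (hq : 2 ≤ q) {m m' n : ℕ}
    (hm : k + m = n) (hm' : l + m' = n)
    (hlt : paMean l T m' (degMoment q n) < paMean k S m (degMoment q n)) :
    ∃ c > 0, ∀ i, c ≤ tvDist (PAtype k S (n + i)) (PAtype l T (n + i)) := by
  set a := paMean k S m (degMoment q n) with ha
  set b := paMean l T m' (degMoment q n) with hb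
  set V := paMean k S m (lyapunov q n) with hV
  have hn : 2 ≤ n := by omega
  have hb0 : 0 ≤ b := by
    rw [← paMean_const hT hl m' 0]
    exact paMean_mono hT hl fun G _ => degMoment_nonneg hq hn G
  have hV0 : 0 ≤ V := by
    rw [← paMean_const hS hk m 0]
    exact paMean_mono hS hk fun G _ => (sq_nonneg _).trans (sq_degMoment_le_lyapunov hq hn G)
  have hab : 0 < a - b := sub_pos.2 hlt
  refine ⟨(a - b) ^ 2 / (4 * (V + 1)), by positivity, fun i => ?_⟩
  have hmi : k + (m + i) = n + i := by omega
  have hmi' : l + (m' + i) = n + i := by omega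
  have := isProbabilityMeasure_PAtype hS hk hmi
  have := isProbabilityMeasure_PAtype hT hl hmi'
  set P := totalGrowth q n i with hP
  have hP0 : 0 < P := totalGrowth_pos q hn i
  have hsq : paMean k S (m + i) (fun G => degMoment q (n + i) G ^ 2) ≤ P ^ 2 * V :=
    (paMean_mono hS hk fun G _ => sq_degMoment_le_lyapunov hq (by omega) G).trans
      (paMean_lyapunov_le hS hk hq hm i)
  set L := 2 * (V + 1) * P / (a - b) with hL
  have hL0 : 0 < L := by positivity
  have key := sub_le_mul_tvDist (PAtype k S (n + i)) (PAtype l T (n + i))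
    (f := typeMoment q (n + i)) measurable_from_top
    (typeMoment_nonneg hq (by omega)) (L := L) (A := P * a) (B := P * b) (M := P ^ 2 * V) hL0
    (by positivity) (by positivity)
    (by
      rw [lintegral_PAtype hS hk hmi (f := degMoment q (n + i)) fun G hG =>
        ⟨by rw [hG.typeMoment_mk], degMoment_nonneg hq (by omega) G⟩,
        paMean_degMoment hS hk hq hm])
    (by
      rw [lintegral_PAtype hT hl hmi' (f := degMoment q (n + i)) fun G hG =>
        ⟨by rw [hG.typeMoment_mk], degMoment_nonneg hq (by omega) G⟩,
        paMean_degMoment hT hl hq hm'])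
    (by
      rw [lintegral_PAtype hS hk hmi (f := fun G => degMoment q (n + i) G ^ 2) fun G hG =>
        ⟨by rw [hG.typeMoment_mk], sq_nonneg _⟩]
      exact ENNReal.ofReal_le_ofReal hsq)
  set t := tvDist (PAtype k S (n + i)) (PAtype l T (n + i))
  have h1 : P ^ 2 * V / L ≤ P * (a - b) / 2 := by
    rw [hL, div_div_eq_mul_div, div_le_iff₀ (by positivity)]
    have : 0 ≤ P ^ 2 * (a - b) := by positivity
    nlinarith
  have h2 : P * ((a - b) / 2) ≤ P * (2 * (V + 1) / (a - b) * t) := by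
    have : L * t = P * (2 * (V + 1) / (a - b) * t) := by rw [hL]; ring
    rw [← this]
    linarith
  have h3 := le_of_mul_le_mul_left h2 hP0
  rw [div_mul_eq_mul_div, le_div_iff₀ hab] at h3
  rw [div_le_iff₀ (by positivity)]
  nlinarith

lemma exists_le_tvDist_of_ne {k l : ℕ} {S T : SimpleGraph ℕ} (hS : TreeLike k S)
    (hT : TreeLike l T) (hk : 2 ≤ k) (hl : 2 ≤ l) {q : ℕ} (hq : 2 ≤ q) {m m' n : ℕ}
    (hm : k + m = n) (hm' : l + m' = n)
    (hne : paMean k S m (degMoment q n) ≠ paMean l T m' (degMoment q n)) :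
    ∃ c > 0, ∀ i, c ≤ tvDist (PAtype k S (n + i)) (PAtype l T (n + i)) := by
  rcases lt_or_gt_of_ne hne with h | h
  · simp only [tvDist_comm (PAtype k S _)]
    exact exists_le_tvDist_of_lt hT hS hl hk hq hm' hm h
  · exact exists_le_tvDist_of_lt hS hT hk hl hq hm hm' h

lemma deltaPA_pos_of_paMean_degMoment_ne {k l : ℕ} {S T : SimpleGraph ℕ} (hS : TreeLike k S)
    (hT : TreeLike l T) (hk : 2 ≤ k) (hl : 2 ≤ l) {q : ℕ} (hq : 2 ≤ q) {m m' n : ℕ}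
    (hm : k + m = n) (hm' : l + m' = n)
    (hne : paMean k S m (degMoment q n) ≠ paMean l T m' (degMoment q n)) :
    0 < deltaPA k S l T := by
  obtain ⟨c, hc, hle⟩ := exists_le_tvDist_of_ne hS hT hk hl hq hm hm' hne
  refine hc.trans_le ?_
  rw [deltaPA]
  refine le_limsup_of_frequently_le (Eventually.frequently ?_) ⟨1, ?_⟩
  · filter_upwards [eventually_ge_atTop n] with j hj
    obtain ⟨i, rfl⟩ := Nat.exists_eq_add_of_le hj
    exact hle i
  · rw [eventually_map]
    filter_upwards [eventually_ge_atTop n] with j hj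
    have := isProbabilityMeasure_PAtype hS hk (show k + (j - k) = j by omega)
    have := isProbabilityMeasure_PAtype hT hl (show l + (j - l) = j by omega)
    exact tvDist_le_one _ _

/-- The number of vertices of degree `d`, as a function of the degree of one vertex. -/
def degInd (d e : ℕ) : ℝ := if e = d then 1 else 0

/-- Rising factorials of arguments `d ≥ 1` are linearly independent as functions of the order, even
when only large orders are tested. -/
lemma eq_zero_of_sum_mul_risingFac_eq_zero (w : ℕ → ℝ) (N : ℕ)
    (h : ∀ q ≥ 2, ∑ d ∈ Finset.range N, w d * risingFac (q + 1) d = 0) :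
    ∀ d, 1 ≤ d → d < N → w d = 0 := by
  induction N with
  | zero => intro d _ hd; omega
  | succ N ih =>
    suffices hN : 1 ≤ N → w N = 0 by
      have h' : ∀ q ≥ 2, ∑ d ∈ Finset.range N, w d * risingFac (q + 1) d = 0 := by
        intro q hq
        have := h q hq
        rw [Finset.sum_range_succ] at this
        rcases Nat.eq_zero_or_pos N with h0 | h0
        · simp [h0]
        · simpa [hN h0] using this
      intro d hd hdN
      rcases Nat.lt_succ_iff_lt_or_eq.1 hdN with h1 | h1
      · exact ih h' d hd h1
      · rw [h1]
        exact hN (h1 ▸ hd)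
    intro hN
    by_contra hw
    obtain ⟨M, rfl⟩ : ∃ M, N = M + 1 := ⟨N - 1, by omega⟩
    set C := ∑ d ∈ Finset.range (M + 1), |w d| with hC
    have hC0 : 0 ≤ C := Finset.sum_nonneg fun _ _ => abs_nonneg _
    have hwpos : 0 < |w (M + 1)| := abs_pos.2 hw
    have hbound : ∀ q ≥ 2, |w (M + 1)| * risingFac (q + 1) (M + 1) ≤ C * risingFac (q + 1) M := by
      intro q hq
      have h1 := h q hq
      rw [Finset.sum_range_succ] at h1
      have h2 : w (M + 1) * risingFac (q + 1) (M + 1) =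
          -∑ d ∈ Finset.range (M + 1), w d * risingFac (q + 1) d := by linarith
      calc |w (M + 1)| * risingFac (q + 1) (M + 1)
          = |w (M + 1) * risingFac (q + 1) (M + 1)| := by
            rw [abs_mul, abs_of_nonneg (risingFac_nonneg _ _)]
        _ = |∑ d ∈ Finset.range (M + 1), w d * risingFac (q + 1) d| := by rw [h2, abs_neg]
        _ ≤ ∑ d ∈ Finset.range (M + 1), |w d * risingFac (q + 1) d| :=
            Finset.abs_sum_le_sum_abs _ _
        _ ≤ ∑ d ∈ Finset.range (M + 1), |w d| * risingFac (q + 1) M := by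
            refine Finset.sum_le_sum fun d hd => ?_
            rw [abs_mul, abs_of_nonneg (risingFac_nonneg _ _)]
            refine mul_le_mul_of_nonneg_left ?_ (abs_nonneg _)
            exact Nat.cast_le.2 (Nat.ascFactorial_le _ (by
              have := Finset.mem_range.1 hd
              omega))
        _ = C * risingFac (q + 1) M := by rw [hC, Finset.sum_mul]
    have hpos : ∀ p e : ℕ, 0 < risingFac p (e + 1) := fun p e =>
      Nat.cast_pos.2 (Nat.ascFactorial_pos e p)
    rcases Nat.eq_zero_or_pos M with rfl | hM
    · have h1 := hbound 2 le_rfl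
      rw [risingFac_zero, mul_zero] at h1
      exact absurd h1 (not_le.2 (mul_pos hwpos (hpos _ _)))
    · obtain ⟨e, rfl⟩ : ∃ e, M = e + 1 := ⟨M - 1, by omega⟩
      obtain ⟨q, hq⟩ := exists_nat_gt (C * ((e + 1 : ℕ) : ℝ) / |w (e + 1 + 1)|)
      have h1 := hbound (q + 2) (by omega)
      have h2 := mul_risingFac_succ (q + 2 + 1) (e + 1)
      have h3 := hpos (q + 2 + 1) e
      rw [div_lt_iff₀ hwpos] at hq
      set r := risingFac (q + 2 + 1) (e + 1)
      set E : ℝ := ((e + 1 : ℕ) : ℝ)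
      have hE : 0 < E := Nat.cast_pos.2 (Nat.succ_pos e)
      have h4 : |w (e + 1 + 1)| * ((E + ((q + 2 + 1 : ℕ) : ℝ)) * r) ≤ C * E * r := by
        rw [← h2]
        nlinarith
      have h5 : |w (e + 1 + 1)| * (E + ((q + 2 + 1 : ℕ) : ℝ)) ≤ C * E := by
        refine le_of_mul_le_mul_right ?_ h3
        linarith
      push_cast at h5
      nlinarith

lemma TreeLike.degSum_eq_sum_degInd {n : ℕ} {G : SimpleGraph ℕ} (h : TreeLike n G) (hn : 2 ≤ n)
    (f : ℕ → ℝ) :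
    degSum f n G = ∑ d ∈ Finset.range (2 * n), f d * degSum (degInd d) n G := by
  simp only [degSum, Finset.mul_sum]
  rw [Finset.sum_comm]
  refine Finset.sum_congr rfl fun v _ => ?_
  have hv : degN G v < 2 * n := by
    have := h.degN_le v
    omega
  simp only [degInd, mul_ite, mul_one, mul_zero]
  rw [Finset.sum_ite_eq, if_pos (Finset.mem_range.2 hv)]

lemma paMean_degMoment_eq_sum {k : ℕ} {T : SimpleGraph ℕ} (hT : TreeLike k T) (hk : 2 ≤ k)
    {m n : ℕ} (hn : k + m = n) (q : ℕ) :
    paMean k T m (degMoment q n) =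
      ∑ d ∈ Finset.range (2 * n), risingFac (q + 1) d * paMean k T m (degSum (degInd d) n) +
        driftCoeff q * ((n : ℝ) - 1) := by
  subst hn
  have h1 : paMean k T m (degMoment q (k + m)) =
      paMean k T m (fun G => (∑ d ∈ Finset.range (2 * (k + m)),
        risingFac (q + 1) d * degSum (degInd d) (k + m) G) +
          driftCoeff q * (((k + m : ℕ) : ℝ) - 1)) :=
    paMean_congr hT hk fun G hG => by
      rw [degMoment, hG.degSum_eq_sum_degInd (by omega)]
  rw [h1, paMean_add, paMean_const hT hk, paMean_sum]
  simp only [paMean_const_mul]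

lemma paMean_degInd_eq {k l : ℕ} {S T : SimpleGraph ℕ} (hS : TreeLike k S)
    (hT : TreeLike l T) (hk : 2 ≤ k) (hl : 2 ≤ l) {m m' n : ℕ}
    (hm : k + m = n) (hm' : l + m' = n)
    (heq : ∀ q ≥ 2, paMean k S m (degMoment q n) = paMean l T m' (degMoment q n)) {d : ℕ}
    (hd : 1 ≤ d) (hdn : d < 2 * n) :
    paMean k S m (degSum (degInd d) n) = paMean l T m' (degSum (degInd d) n) := by
  refine sub_eq_zero.1 (eq_zero_of_sum_mul_risingFac_eq_zero
    (fun d => paMean k S m (degSum (degInd d) n) - paMean l T m' (degSum (degInd d) n)) (2 * n)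
    (fun q hq => ?_) d hd hdn)
  have := heq q hq
  rw [paMean_degMoment_eq_sum hS hk hm, paMean_degMoment_eq_sum hT hl hm'] at this
  simp only [sub_mul, Finset.sum_sub_distrib, mul_comm (paMean _ _ _ _)]
  linarith

lemma degSum_degInd (d n : ℕ) (G : SimpleGraph ℕ) :
    degSum (degInd d) n G = (((Multiset.range n).map (degN G)).count d : ℕ) := by
  rw [Multiset.count_map, degSum]
  simp only [degInd, Finset.sum_boole]
  congr 1
  rw [← Finset.range_val, ← Finset.filter_val, Finset.card_val]
  exact congrArg Finset.card (Finset.filter_congr fun _ _ => eq_comm)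

lemma TreeLike.vecd_eq {k : ℕ} {S T : SimpleGraph ℕ} (hS : TreeLike k S) (hT : TreeLike k T)
    (hk : 2 ≤ k)
    (h : ∀ d, 1 ≤ d → d < 2 * k → degSum (degInd d) k S = degSum (degInd d) k T) :
    vecd k S = vecd k T := by
  have hcount : (Multiset.range k).map (degN S) = (Multiset.range k).map (degN T) := by
    ext d
    by_cases hd : 1 ≤ d ∧ d < 2 * k
    · have := h d hd.1 hd.2
      rw [degSum_degInd, degSum_degInd] at this
      exact_mod_cast this
    · have key : ∀ {G : SimpleGraph ℕ}, TreeLike k G →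
          ((Multiset.range k).map (degN G)).count d = 0 := by
        intro G hG
        rw [Multiset.count_eq_zero, Multiset.mem_map]
        rintro ⟨v, hv, rfl⟩
        have h1 := hG.one_le_degN v (Multiset.mem_range.1 hv)
        have h2 := hG.degN_le v
        omega
      rw [key hS, key hT]
  unfold vecd
  rw [hcount]

lemma TreeLike.stepMean_degInd_succ {n : ℕ} {G : SimpleGraph ℕ} (h : TreeLike n G) (hn : 2 ≤ n)
    {e : ℕ} (he : 1 ≤ e) :
    stepMean n (degSum (degInd (e + 1)) (n + 1)) G =
      (1 - ((e : ℝ) + 1) / (2 * ((n : ℝ) - 1))) * degSum (degInd (e + 1)) n G +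
        (e : ℝ) / (2 * ((n : ℝ) - 1)) * degSum (degInd e) n G := by
  have h1 : degSum (fun d => d * (degInd (e + 1) (d + 1) - degInd (e + 1) d)) n G =
      e * degSum (degInd e) n G - (e + 1) * degSum (degInd (e + 1)) n G := by
    simp only [degSum, Finset.mul_sum, ← Finset.sum_sub_distrib]
    refine Finset.sum_congr rfl fun v _ => ?_
    simp only [degInd, add_left_inj]
    split_ifs with h1 h2 h2
    · omega
    · rw [h1]; ring
    · rw [h2]; push_cast; ring
    · ring
  have h2 : degInd (e + 1) 1 = 0 := if_neg (by omega)
  rw [h.stepMean_degSum hn, h1, h2]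
  ring

lemma paMean_degInd_succ {k : ℕ} {T : SimpleGraph ℕ} (hT : TreeLike k T) (hk : 2 ≤ k) (m : ℕ)
    {e : ℕ} (he : 1 ≤ e) :
    paMean k T (m + 1) (degSum (degInd (e + 1)) (k + (m + 1))) =
      (1 - ((e : ℝ) + 1) / (2 * (((k + m : ℕ) : ℝ) - 1))) *
          paMean k T m (degSum (degInd (e + 1)) (k + m)) +
        (e : ℝ) / (2 * (((k + m : ℕ) : ℝ) - 1)) * paMean k T m (degSum (degInd e) (k + m)) := by
  rw [← paMean_const_mul, ← paMean_const_mul, ← paMean_add]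
  exact paMean_congr hT hk (f := stepMean (k + m) _) fun G hG =>
    hG.stepMean_degInd_succ (by omega) he

lemma paMean_degInd_eq_zero {k : ℕ} {T : SimpleGraph ℕ} (hT : TreeLike k T) (hk : 2 ≤ k)
    {Δ : ℕ} (hΔ : 1 ≤ Δ) (hmax : ∀ v < k, degN T v ≤ Δ) (m : ℕ) {d : ℕ} (hd : Δ + m < d) :
    paMean k T m (degSum (degInd d) (k + m)) = 0 := by
  induction m generalizing d with
  | zero =>
    refine Finset.sum_eq_zero (s := Finset.range k) fun v hv => if_neg ?_
    have := hmax v (Finset.mem_range.1 hv)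
    omega
  | succ m ih =>
    obtain ⟨e, rfl⟩ : ∃ e, d = e + 1 := ⟨d - 1, by omega⟩
    rw [paMean_degInd_succ hT hk m (by omega), ih (by omega), ih (by omega)]
    ring

lemma paMean_degInd_top {k : ℕ} {T : SimpleGraph ℕ} (hT : TreeLike k T) (hk : 2 ≤ k)
    {Δ : ℕ} (hΔ : 1 ≤ Δ) (hmax : ∀ v < k, degN T v ≤ Δ) (m : ℕ) :
    paMean k T (m + 1) (degSum (degInd (Δ + (m + 1))) (k + (m + 1))) =
      ((Δ + m : ℕ) : ℝ) / (2 * (((k + m : ℕ) : ℝ) - 1)) *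
        paMean k T m (degSum (degInd (Δ + m)) (k + m)) := by
  have := paMean_degInd_succ hT hk m (e := Δ + m) (by omega)
  rw [paMean_degInd_eq_zero hT hk hΔ hmax m (d := Δ + m + 1) (by omega), mul_zero, zero_add] at this
  exact this

lemma TreeLike.exists_max_degN {k : ℕ} {T : SimpleGraph ℕ} (hT : TreeLike k T) (hk : 3 ≤ k) :
    ∃ Δ, 1 ≤ Δ ∧ Δ ≤ 2 * (k - 1) ∧ (∀ v < k, degN T v ≤ Δ) ∧ 0 < degSum (degInd Δ) k T ∧
      Δ * degSum (degInd Δ) k T < 2 * ((k : ℝ) - 1) := by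
  obtain ⟨u, hu, hmax⟩ := (Finset.range k).exists_max_image (degN T) ⟨0, by simp; omega⟩
  have huk := Finset.mem_range.1 hu
  refine ⟨degN T u, hT.one_le_degN u huk, hT.degN_le u,
    fun v hv => hmax v (Finset.mem_range.2 hv), ?_, ?_⟩
  · refine Finset.sum_pos' (fun v _ => ?_) ⟨u, hu, by simp [degInd]⟩
    rw [degInd]
    split_ifs <;> norm_num
  · obtain ⟨v, hv, hvu⟩ : ∃ v ∈ Finset.range k, degN T v ≠ degN T u := by
      by_contra! hall
      have h1 := hT.sum_degN
      rw [Finset.sum_congr rfl hall, Finset.sum_const, Finset.card_range, smul_eq_mul] at h1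
      rcases Nat.lt_or_ge (degN T u) 2 with h2 | h2
      · interval_cases degN T u <;> omega
      · have := Nat.mul_le_mul_left k h2
        omega
    rw [← hT.degSum_id (by omega), degSum, Finset.mul_sum, degSum]
    refine Finset.sum_lt_sum (fun w _ => ?_) ⟨v, hv, ?_⟩
    · simp only [degInd, mul_ite, mul_one, mul_zero]
      split_ifs with hw
      · rw [hw]
      · exact Nat.cast_nonneg _
    · simp only [degInd, hvu, if_false, mul_zero]
      exact Nat.cast_pos.2 (hT.one_le_degN v (Finset.mem_range.1 hv))

/-- Some expected degree count at a later time is not an integer. -/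
lemma TreeLike.exists_paMean_degInd_mem_Ioo {k : ℕ} {T : SimpleGraph ℕ} (hT : TreeLike k T)
    (hk : 3 ≤ k) (m : ℕ) :
    ∃ d, 1 ≤ d ∧ d < 2 * (k + (m + 1)) ∧
      paMean k T (m + 1) (degSum (degInd d) (k + (m + 1))) ∈ Set.Ioo (0 : ℝ) 1 := by
  obtain ⟨Δ, hΔ1, hΔ2, hmax, hpos, hlt⟩ := hT.exists_max_degN hk
  refine ⟨Δ + (m + 1), by omega, by omega, ?_⟩
  have hk' : (3 : ℝ) ≤ k := by exact_mod_cast hk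
  have hΔ1' : (1 : ℝ) ≤ Δ := by exact_mod_cast hΔ1
  have hΔ2' : (Δ : ℝ) ≤ 2 * ((k : ℝ) - 1) := by
    have := Nat.cast_le (α := ℝ).2 hΔ2
    push_cast [Nat.cast_sub (show 1 ≤ k by omega)] at this
    exact this
  induction m with
  | zero =>
    have h1 := paMean_degInd_top hT (by omega) hΔ1 hmax 0
    simp only [paMean, add_zero, zero_add] at h1
    simp only [paMean, add_zero, zero_add, h1]
    have : (0 : ℝ) < 2 * ((k : ℝ) - 1) := by linarith
    constructor
    · positivity
    · rw [div_mul_eq_mul_div, div_lt_one this]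
      exact hlt
  | succ m ih =>
    rw [paMean_degInd_top hT (by omega) hΔ1 hmax (m + 1)]
    have hm0 : (0 : ℝ) ≤ m := Nat.cast_nonneg m
    push_cast at ih ⊢
    have hden : (0 : ℝ) < 2 * ((k : ℝ) + (m + 1) - 1) := by linarith
    have hfac : ((Δ : ℝ) + (m + 1)) / (2 * ((k : ℝ) + (m + 1) - 1)) ≤ 1 := by
      rw [div_le_one hden]
      linarith
    have hfac0 : 0 < ((Δ : ℝ) + (m + 1)) / (2 * ((k : ℝ) + (m + 1) - 1)) :=
      div_pos (by linarith) hden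
    exact ⟨mul_pos hfac0 ih.1, (mul_le_of_le_one_left ih.1.le hfac).trans_lt ih.2⟩

lemma TreeLike.deltaPA_pos_of_le {k l : ℕ} (hk : 3 ≤ k) (hl : 3 ≤ l) {S T : SimpleGraph ℕ}
    (hS : TreeLike k S) (hT : TreeLike l T) (hne : vecd k S ≠ vecd l T) (hkl : k ≤ l) :
    0 < deltaPA k S l T := by
  obtain ⟨m, rfl⟩ := Nat.exists_eq_add_of_le hkl
  by_cases heq : ∀ q ≥ 2, paMean k S m (degMoment q (k + m)) =
      paMean (k + m) T 0 (degMoment q (k + m))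
  · exfalso
    have hcount : ∀ d, 1 ≤ d → d < 2 * (k + m) →
        paMean k S m (degSum (degInd d) (k + m)) = degSum (degInd d) (k + m) T := fun d hd hdn =>
      paMean_degInd_eq hS hT (by omega) (by omega) rfl rfl heq hd hdn
    cases m with
    | zero => exact hne (hS.vecd_eq hT (by omega) hcount)
    | succ m =>
      obtain ⟨d, hd, hdn, h0, h1⟩ := hS.exists_paMean_degInd_mem_Ioo hk m
      rw [hcount d hd hdn, degSum_degInd] at h0 h1
      have h0' := Nat.cast_pos.1 h0
      have h1' := Nat.cast_lt_one.1 h1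
      omega
  · push Not at heq
    obtain ⟨q, hq, hneq⟩ := heq
    exact deltaPA_pos_of_paMean_degMoment_ne hS hT (by omega) (by omega) hq rfl rfl hneq

/-- If two seed trees `S` and `T`, each on at least 3 vertices, have different degree
profiles, then `δ(S, T) > 0`. -/
theorem seed_influence_of_ne_degree_profile
    (kS kT : ℕ) (hkS : 3 ≤ kS) (hkT : 3 ≤ kT)
    (S T : SimpleGraph ℕ) (hS : IsTreeOn kS S) (hT : IsTreeOn kT T)
    (hprof : vecd kS S ≠ vecd kT T) :
    0 < deltaPA kS S kT T := by
  have hS' := hS.treeLike (by omega)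
  have hT' := hT.treeLike (by omega)
  rcases le_total kS kT with h | h
  · exact hS'.deltaPA_pos_of_le hkS hkT hT' hprof h
  · have := hT'.deltaPA_pos_of_le hkT hkS hS' hprof.symm h
    simp only [deltaPA, tvDist_comm (PAtype kS S _)]
    exact this


end
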